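/- If S is a Tutte-Berge set of a finite graph G (some matching leaves exactly od(S) - |S| vertices exposed) chosen to minimize the total number of vertices in odd S-components, then every odd S-component is factor-critical. -/

import Mathlib

open SimpleGraph Set

variable {V : Type*} [Fintype V] [DecidableEq V]

/-- The vertex set (in `V`) of a connected component of the graph induced on `B`. -/
def compSupp (G : SimpleGraph V) (B : Set V)
    (c : (G.induce B).ConnectedComponent) : Set V :=
  Subtype.val '' c.supp

/-- `A` is (the vertex set of) a connected component of `G` restricted to `B`. -/
def IsCompOf (G : SimpleGraph V) (B : Set V) (A : Set V) : Prop :=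
  ∃ c : (G.induce B).ConnectedComponent, A = compSupp G B c

/-- The number of odd connected components of `G` restricted to `B`. -/
noncomputable def oddComps (G : SimpleGraph V) (B : Set V) : ℕ :=
  Set.ncard {c : (G.induce B).ConnectedComponent | Odd (compSupp G B c).ncard}

/-- The deficiency `df(S) = od(S) - |S|`. -/
noncomputable def df (G : SimpleGraph V) (S : Set V) : ℤ :=
  (oddComps G Sᶜ : ℤ) - S.ncard

/-- The induced subgraph on `A` has a perfect matching. -/
def HasPM (G : SimpleGraph V) (A : Set V) : Prop :=
  ∃ M : Subgraph (G.induce A), M.IsPerfectMatching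

/-- `Df(S)`: total number of vertices in components of `G - S` with no perfect matching. -/
noncomputable def Df (G : SimpleGraph V) (S : Set V) : ℕ :=
  Set.ncard (⋃ c ∈ {c : (G.induce Sᶜ).ConnectedComponent |
    ¬ HasPM G (compSupp G Sᶜ c)}, compSupp G Sᶜ c)

/-- The set of `M`-exposed vertices. -/
def exposed (G : SimpleGraph V) (M : Subgraph G) : Set V :=
  {v | v ∉ M.support}

/-- `A` induces a factor-critical graph. -/
def FactorCritical (G : SimpleGraph V) (A : Set V) : Prop :=
  ∀ v ∈ A, HasPM G (A \ {v})

/-- The neighborhood of `T ⊆ S` in the bipartite minor `⟨G,S⟩`: the odd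
`S`-components adjacent to some vertex of `T`. -/
def minorNbhd (G : SimpleGraph V) (S T : Set V) :
    Set (G.induce Sᶜ).ConnectedComponent :=
  {c | Odd (compSupp G Sᶜ c).ncard ∧ ∃ u ∈ T, ∃ w ∈ compSupp G Sᶜ c, G.Adj u w}

/-- `S` is a Gallai-Edmonds set of `G`. -/
def GallaiEdmonds (G : SimpleGraph V) (S : Set V) : Prop :=
  (∀ c : (G.induce Sᶜ).ConnectedComponent,
      Even (compSupp G Sᶜ c).ncard → HasPM G (compSupp G Sᶜ c)) ∧
  (∀ c : (G.induce Sᶜ).ConnectedComponent,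
      Odd (compSupp G Sᶜ c).ncard → FactorCritical G (compSupp G Sᶜ c)) ∧
  (∀ T ⊆ S, T.Nonempty → T.ncard + 1 ≤ (minorNbhd G S T).ncard)

/-- `w` and `w'` lie in the same `S`-component. -/
def SameComp (G : SimpleGraph V) (S : Set V) (w w' : V) : Prop :=
  ∃ c : (G.induce Sᶜ).ConnectedComponent,
    w ∈ compSupp G Sᶜ c ∧ w' ∈ compSupp G Sᶜ c

/-- `M` is a maximum matching of `G`. -/
def IsMaximumMatching (G : SimpleGraph V) (M : Subgraph G) : Prop :=
  M.IsMatching ∧ ∀ M' : Subgraph G, M'.IsMatching →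
    M'.edgeSet.ncard ≤ M.edgeSet.ncard
/-- closed under adjacency within `B` -/
def ClosedIn (G : SimpleGraph V) (B X : Set V) : Prop :=
  ∀ x ∈ X, ∀ y ∈ B, G.Adj x y → y ∈ X

/-- minimal nonempty closed subset -/
def MinC (G : SimpleGraph V) (B A : Set V) : Prop :=
  A ⊆ B ∧ A.Nonempty ∧ ClosedIn G B A ∧ ∀ X ⊆ A, X.Nonempty → ClosedIn G B X → A ⊆ X

/-- odd components as sets -/
def OC (G : SimpleGraph V) (B : Set V) : Set (Set V) := {A | MinC G B A ∧ Odd A.ncard}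

lemma MinC.eq_of_mem {G : SimpleGraph V} {B A A' : Set V} (h : MinC G B A) (h' : MinC G B A')
    {x : V} (hx : x ∈ A) (hx' : x ∈ A') : A = A' := by
  have hc : ClosedIn G B (A ∩ A') := fun a ha y hy hay =>
    ⟨h.2.2.1 a ha.1 y hy hay, h'.2.2.1 a ha.2 y hy hay⟩
  have h1 := h.2.2.2 (A ∩ A') inter_subset_left ⟨x, hx, hx'⟩ hc
  have h2 := h'.2.2.2 (A ∩ A') inter_subset_right ⟨x, hx, hx'⟩ hc
  exact Subset.antisymm (fun a ha => (h1 ha).2) (fun a ha => (h2 ha).1)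

lemma minC_image {W : Type*} (K : SimpleGraph W) (G : SimpleGraph V) (f : W → V)
    (hf : ∀ a b, K.Adj a b ↔ G.Adj (f a) (f b)) (B : Set V)
    (hB : Set.range f = B) (c : K.ConnectedComponent) : MinC G B (f '' c.supp) := by
  subst hB
  refine ⟨image_subset_range _ _, c.nonempty_supp.image f, ?_, ?_⟩
  · rintro _ ⟨a, ha, rfl⟩ _ ⟨b, rfl⟩ hab
    exact ⟨b, (c.mem_supp_congr_adj ((hf a b).2 hab)).1 ha, rfl⟩
  · rintro X hX ⟨x, hx⟩ hcl
    obtain ⟨a, ha, rfl⟩ := hX hx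
    rintro _ ⟨b, hb, rfl⟩
    have hr : K.Reachable a b := by
      rw [ConnectedComponent.mem_supp_iff] at ha hb
      exact ConnectedComponent.exact (ha.trans hb.symm)
    obtain ⟨w⟩ := hr
    clear hb ha
    induction w with
    | nil => exact hx
    | cons h p ih => exact ih (hcl _ hx _ ⟨_, rfl⟩ ((hf _ _).1 h))

lemma compSupp_minC (G : SimpleGraph V) (B : Set V) (c : (G.induce B).ConnectedComponent) :
    MinC G B (compSupp G B c) :=
  minC_image (G.induce B) G Subtype.val (fun _ _ => Iff.rfl) B Subtype.range_val c

lemma exists_comp (G : SimpleGraph V) (B : Set V) {x : V} (hx : x ∈ B) :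
    ∃ c, x ∈ compSupp G B c :=
  ⟨(G.induce B).connectedComponentMk ⟨x, hx⟩, ⟨x, hx⟩, rfl, rfl⟩

lemma compSupp_injective (G : SimpleGraph V) (B : Set V) :
    Function.Injective (compSupp G B) := fun _ _ h =>
  ConnectedComponent.supp_injective (Subtype.val_injective.image_injective h)

lemma MinC.exists_comp {G : SimpleGraph V} {B A : Set V} (h : MinC G B A) :
    ∃ c, compSupp G B c = A := by
  obtain ⟨x, hx⟩ := h.2.1
  obtain ⟨c, hc⟩ := _root_.exists_comp G B (h.1 hx)
  exact ⟨c, (compSupp_minC G B c).eq_of_mem h hc hx⟩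

lemma oddComps_eq (G : SimpleGraph V) (B : Set V) : oddComps G B = (OC G B).ncard := by
  rw [oddComps, ← ncard_image_of_injective _ (compSupp_injective G B)]
  congr 1
  ext A
  constructor
  · rintro ⟨c, hc, rfl⟩
    exact ⟨compSupp_minC G B c, hc⟩
  · rintro ⟨h, ho⟩
    obtain ⟨c, rfl⟩ := h.exists_comp
    exact ⟨c, ho, rfl⟩

lemma union_eq (G : SimpleGraph V) (B : Set V) :
    (⋃ c ∈ {c : (G.induce B).ConnectedComponent | Odd (compSupp G B c).ncard}, compSupp G B c)
      = ⋃₀ OC G B := by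
  ext x
  simp only [mem_iUnion, mem_sUnion, mem_setOf_eq, exists_prop]
  constructor
  · rintro ⟨c, hc, hx⟩
    exact ⟨_, ⟨compSupp_minC G B c, hc⟩, hx⟩
  · rintro ⟨A, ⟨h, ho⟩, hx⟩
    obtain ⟨c, rfl⟩ := h.exists_comp
    exact ⟨c, ho, hx⟩

lemma even_of_matched (G : SimpleGraph V) (M : Subgraph G) (hM : M.IsMatching) (A : Set V)
    (h : ∀ a ∈ A, ∃ b ∈ A, M.Adj a b) : Even A.ncard := by
  classical
  have hm : (M.induce A).IsMatching := by
    intro a ha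
    obtain ⟨b, hb, hab⟩ := h a ha
    refine ⟨b, ⟨ha, hb, hab⟩, ?_⟩
    rintro y ⟨_, _, hy⟩
    exact hM.eq_of_adj_left hy hab
  have := hm.even_card
  rw [← Set.ncard_eq_toFinset_card'] at this
  exact this

lemma weak_duality (G : SimpleGraph V) (M : Subgraph G) (hM : M.IsMatching) (S : Set V) :
    df G S ≤ (exposed G M).ncard := by
  classical
  have key : ∀ A ∈ OC G Sᶜ, ∃ g : V, (g ∈ exposed G M ∧ g ∈ A) ∨ (g ∈ S ∧ ∃ a ∈ A, M.Adj a g) := by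
    rintro A ⟨hA, ho⟩
    by_contra! hcon
    refine (Nat.not_even_iff_odd.2 ho) (even_of_matched G M hM A ?_)
    intro a ha
    have h1 : a ∈ M.support := by
      by_contra h
      exact (hcon a).1 h ha
    obtain ⟨b, hab⟩ := (M.mem_support).1 h1
    refine ⟨b, hA.2.2.1 a ha b ?_ hab.adj_sub, hab⟩
    intro hb
    exact (hcon b).2 hb a ha hab
  rcases isEmpty_or_nonempty V with hV | hV
  · have h0 : OC G Sᶜ = ∅ := by
      ext A
      refine ⟨?_, fun h => h.elim⟩
      rintro ⟨hA, _⟩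
      exact (hV.false hA.2.1.some).elim
    rw [df, oddComps_eq, h0, ncard_empty]
    omega
  choose! g hg using key
  have hle : (OC G Sᶜ).ncard ≤ (exposed G M ∪ S).ncard := by
    refine ncard_le_ncard_of_injOn g ?_ ?_ (toFinite _)
    · intro A hA
      rcases hg A hA with h | h
      · exact Or.inl h.1
      · exact Or.inr h.1
    · intro A hA A' hA' he
      rcases hg A hA with h | ⟨h, a, ha, hag⟩ <;> rcases hg A' hA' with h' | ⟨h', b, hb, hbg⟩
      · exact hA.1.eq_of_mem hA'.1 h.2 (he ▸ h'.2)
      · exact absurd (he ▸ h') (hA.1.1 h.2)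
      · exact absurd (he ▸ h) (hA'.1.1 h'.2)
      · rw [← he] at hbg
        have : a = b := hM.eq_of_adj_right hag hbg
        subst this
        exact hA.1.eq_of_mem hA'.1 ha hb
  have := ncard_union_le (exposed G M) S
  rw [df, oddComps_eq]
  omega

lemma tutte_set (G : SimpleGraph V) (A : Set V) (hev : Even A.ncard) (h : ¬ HasPM G A) :
    ∃ T ⊆ A, T.ncard + 2 ≤ (OC G (A \ T)).ncard := by
  classical
  have h2 := mt (SimpleGraph.tutte (G := G.induce A)).2 h
  push Not at h2
  obtain ⟨u, hu⟩ := h2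
  rw [IsTutteViolator] at hu
  set K := ((⊤ : Subgraph (G.induce A)).deleteVerts u).coe with hK
  let f : ((⊤ : Subgraph (G.induce A)).deleteVerts u).verts → V := fun x => x.1.1
  have hfi : Function.Injective f := fun x y hxy => Subtype.ext (Subtype.ext hxy)
  have hfa : ∀ a b, K.Adj a b ↔ G.Adj (f a) (f b) := by
    rintro ⟨a, ha⟩ ⟨b, hb⟩
    simp at ha hb
    simp [hK, f, Subgraph.deleteVerts_adj, ha, hb]
  have hr : Set.range f = A \ (Subtype.val '' u) := by
    ext x
    constructor
    · rintro ⟨⟨⟨a, haA⟩, ha⟩, rfl⟩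
      simp at ha
      refine ⟨haA, ?_⟩
      rintro ⟨y, hy, hya⟩
      have : y = ⟨a, haA⟩ := Subtype.ext hya
      exact ha (this ▸ hy)
    · rintro ⟨hx, hxu⟩
      refine ⟨⟨⟨x, hx⟩, ?_⟩, rfl⟩
      simp
      intro hh
      exact hxu ⟨_, hh, rfl⟩
  have hle : K.oddComponents.ncard ≤ (OC G (A \ (Subtype.val '' u))).ncard := by
    refine ncard_le_ncard_of_injOn (fun c => f '' c.supp) ?_ ?_ (toFinite _)
    · intro c hc
      refine ⟨minC_image K G f hfa _ hr c, ?_⟩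
      rw [ncard_image_of_injective _ hfi]
      exact hc
    · intro c _ c' _ he
      exact ConnectedComponent.supp_injective (hfi.image_injective he)
  have hpar := K.odd_ncard_oddComponents
  have hcard : Nat.card ((⊤ : Subgraph (G.induce A)).deleteVerts u).verts + u.ncard = A.ncard := by
    have h1 : Nat.card ((⊤ : Subgraph (G.induce A)).deleteVerts u).verts = (Set.range f).ncard := by
      rw [← image_univ, ncard_image_of_injective _ hfi, ncard_univ]
    rw [h1, hr, ← ncard_image_of_injective u Subtype.val_injective]
    exact ncard_diff_add_ncard_of_subset (by rintro _ ⟨y, _, rfl⟩; exact y.2)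
  refine ⟨Subtype.val '' u, by rintro _ ⟨y, _, rfl⟩; exact y.2, ?_⟩
  rw [ncard_image_of_injective u Subtype.val_injective]
  refine le_trans ?_ hle
  grind

/-- If `S` is a Tutte-Berge set minimizing the total number of vertices in odd
`S`-components, then every odd `S`-component is factor-critical. -/
theorem stmt_18 (G : SimpleGraph V) (S : Set V)
    (hTB : ∃ M : Subgraph G, M.IsMatching ∧ ((exposed G M).ncard : ℤ) = df G S)
    (hmin : ∀ S' : Set V,
      (∃ M : Subgraph G, M.IsMatching ∧ ((exposed G M).ncard : ℤ) = df G S') →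
      (⋃ c ∈ {c : (G.induce Sᶜ).ConnectedComponent |
          Odd (compSupp G Sᶜ c).ncard}, compSupp G Sᶜ c).ncard ≤
      (⋃ c ∈ {c : (G.induce S'ᶜ).ConnectedComponent |
          Odd (compSupp G S'ᶜ c).ncard}, compSupp G S'ᶜ c).ncard) :
    ∀ c : (G.induce Sᶜ).ConnectedComponent,
      Odd (compSupp G Sᶜ c).ncard → FactorCritical G (compSupp G Sᶜ c) := by
  intro c ho v hv
  by_contra hno
  obtain ⟨M, hM, hMe⟩ := hTB
  have hC := compSupp_minC G Sᶜ c
  set C := compSupp G Sᶜ c with hCdef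
  have hcv : (C \ {v}).ncard + 1 = C.ncard := ncard_diff_singleton_add_one hv
  obtain ⟨T, hT, hTc⟩ := tutte_set G (C \ {v}) (by grind) hno
  set D := (C \ {v}) \ T with hD
  have hDC : D ⊆ C := fun x hx => hx.1.1
  set S' : Set V := S ∪ insert v T with hS'
  have hBB : S'ᶜ ⊆ Sᶜ := compl_subset_compl.2 subset_union_left
  have hCB : ∀ x ∈ C, x ∈ S'ᶜ → x ∈ D := by
    intro x hx hx'
    simp only [hS', mem_compl_iff, mem_union, mem_insert_iff, not_or] at hx'
    exact ⟨⟨hx, hx'.2.1⟩, hx'.2.2⟩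
  have hDB : D ⊆ S'ᶜ := by
    rintro x ⟨⟨hx, hxv⟩, hxT⟩ (h | h | h)
    · exact hC.1 hx h
    · exact hxv h
    · exact hxT h
  have hnC : ∀ x ∈ Sᶜ, x ∉ C → x ∈ S'ᶜ := by
    rintro x hx hxC (h | h | h)
    · exact hx h
    · exact hxC (h ▸ hv)
    · exact hxC (hT h).1
  -- other components persist
  have hpers : ∀ A, MinC G Sᶜ A → A ≠ C → MinC G S'ᶜ A := by
    intro A hA hne
    have hAB : A ⊆ S'ᶜ := fun x hx =>
      hnC x (hA.1 hx) (fun hxC => hne (hA.eq_of_mem hC hx hxC))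
    refine ⟨hAB, hA.2.1, fun x hx y hy => hA.2.2.1 x hx y (hBB hy), ?_⟩
    intro X hX hXn hXc
    exact hA.2.2.2 X hX hXn (fun x hx y hy hxy =>
      hXc x hx y (hAB (hA.2.2.1 x (hX hx) y hy hxy)) hxy)
  have hnew : ∀ A, MinC G D A → MinC G S'ᶜ A := by
    intro A hA
    refine ⟨hA.1.trans hDB, hA.2.1, ?_, ?_⟩
    · intro x hx y hy hxy
      exact hA.2.2.1 x hx y (hCB y (hC.2.2.1 x (hDC (hA.1 hx)) y (hBB hy) hxy) hy) hxy
    · intro X hX hXn hXc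
      exact hA.2.2.2 X hX hXn (fun x hx y hy => hXc x hx y (hDB hy))
  have hcount : (OC G Sᶜ).ncard + (OC G D).ncard ≤ (OC G S'ᶜ).ncard + 1 := by
    have hsub : (OC G Sᶜ \ {C}) ∪ OC G D ⊆ OC G S'ᶜ := by
      rintro A (⟨⟨hA, hAo⟩, hne⟩ | ⟨hA, hAo⟩)
      · exact ⟨hpers A hA hne, hAo⟩
      · exact ⟨hnew A hA, hAo⟩
    have hdis : Disjoint (OC G Sᶜ \ {C}) (OC G D) := by
      rw [Set.disjoint_left]
      rintro A ⟨⟨hA, _⟩, hne⟩ ⟨hA', _⟩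
      obtain ⟨x, hx⟩ := hA.2.1
      exact hne (hA.eq_of_mem hC hx (hDC (hA'.1 hx)))
    have h1 := ncard_le_ncard hsub (toFinite _)
    rw [ncard_union_eq hdis (toFinite _) (toFinite _)] at h1
    have h2 : (OC G Sᶜ \ {C}).ncard + 1 = (OC G Sᶜ).ncard :=
      ncard_diff_singleton_add_one ⟨hC, ho⟩
    omega
  have hS'c : S'.ncard ≤ S.ncard + T.ncard + 1 := by
    have h1 := ncard_union_le S (insert v T)
    have h2 := ncard_insert_le v T
    rw [← hS'] at h1
    omega
  have hle := weak_duality G M hM S'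
  have heq : ((exposed G M).ncard : ℤ) = df G S' := by
    rw [df, oddComps_eq] at hMe hle ⊢
    omega
  have hm := hmin S' ⟨M, hM, heq⟩
  rw [union_eq, union_eq] at hm
  have hlt : (⋃₀ OC G S'ᶜ).ncard < (⋃₀ OC G Sᶜ).ncard := by
    refine ncard_lt_ncard ?_ (toFinite _)
    rw [Set.ssubset_iff_of_subset]
    · refine ⟨v, ⟨C, ⟨hC, ho⟩, hv⟩, ?_⟩
      rintro ⟨A, ⟨hA, _⟩, hvA⟩
      exact hA.1 hvA (Or.inr (Or.inl rfl))
    · rintro x ⟨A, ⟨hA, hAo⟩, hx⟩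
      by_cases hxC : x ∈ C
      · exact ⟨C, ⟨hC, ho⟩, hxC⟩
      · obtain ⟨c', hc'⟩ := exists_comp G Sᶜ (hBB (hA.1 hx))
        have hm' := compSupp_minC G Sᶜ c'
        have h1 := hpers _ hm' (fun h => hxC (h ▸ hc'))
        have h2 := hA.eq_of_mem h1 hx hc'
        exact ⟨A, ⟨h2 ▸ hm', hAo⟩, hx⟩
  omega
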